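/- (Krasner's disc covering) Let K be a finite extension of Q_p, f an Eisenstein polynomial of degree n over K with v_P(disc(f)) = n + J_0 − 1, and c a rational number with c > 1 + 2J_0/n. Let g be a monic degree-n polynomial over O_K with g_i ≡ f_i (mod P^c) for all i (i.e., v_P(g_i − f_i) ≥ c). If α is a root of f and β is a root of g with |β − α| minimal, then α ∈ K(β); in particular K(α) = K(β) and g is Eisenstein with the same degree and discriminant valuation as f. -/

import Mathlib

open Polynomial

/-- An additive valuation `v` (written additively, with `v 0 = ⊤`) on a field `Ω`,
extending the `p`-adic valuation of `ℚ_[p]` (scaled by the ramification index `e`),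
taking integer values on an intermediate field `K` and normalized so that a
uniformizer `unif` of `K` has valuation `1`. -/
structure PadicSetup (p : ℕ) [Fact p.Prime] (K Ω : Type*) [Field K] [Field Ω]
    [Algebra ℚ_[p] K] [Algebra ℚ_[p] Ω] [Algebra K Ω] [IsScalarTower ℚ_[p] K Ω] where
  v : Ω → WithTop ℚ
  v_top_iff : ∀ x : Ω, v x = ⊤ ↔ x = 0
  v_mul : ∀ x y : Ω, v (x * y) = v x + v y
  v_add : ∀ x y : Ω, min (v x) (v y) ≤ v (x + y)
  e : ℕ
  e_pos : 0 < e
  v_padic : ∀ x : ℚ_[p], x ≠ 0 →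
    v (algebraMap ℚ_[p] Ω x) = (((e : ℤ) * x.valuation : ℤ) : ℚ)
  v_int : ∀ x : K, x ≠ 0 → ∃ m : ℤ, v (algebraMap K Ω x) = ((m : ℚ) : WithTop ℚ)
  unif : K
  v_unif : v (algebraMap K Ω unif) = 1

variable {p : ℕ} [Fact p.Prime] {K Ω : Type*} [Field K] [Field Ω]
    [Algebra ℚ_[p] K] [Algebra ℚ_[p] Ω] [Algebra K Ω] [IsScalarTower ℚ_[p] K Ω]

/-- `f` is an Eisenstein polynomial of degree `n` over `K` (with respect to the
normalized valuation of `K`): monic of degree `n`, all lower coefficients have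
valuation at least `1`, and the constant coefficient has valuation exactly `1`. -/
def PadicSetup.IsEisensteinOfDegree (S : PadicSetup p K Ω) (f : K[X]) (n : ℕ) : Prop :=
  f.Monic ∧ f.natDegree = n ∧ (∀ i < n, 1 ≤ S.v (algebraMap K Ω (f.coeff i))) ∧
    S.v (algebraMap K Ω (f.coeff 0)) = 1

/-- The `i`-th coefficient of the ramification polynomial `ρ(x) = f(αx+α)/αⁿ` of `f`,
namely `ρ_i = ∑_{k=i}^n C(k,i) f_k α^{k-n}`. -/
noncomputable def PadicSetup.rho (S : PadicSetup p K Ω) (f : K[X]) (n : ℕ) (α : Ω)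
    (i : ℕ) : Ω :=
  ∑ k ∈ Finset.Icc i n, (k.choose i : Ω) * algebraMap K Ω (f.coeff k) * α ^ ((k : ℤ) - (n : ℤ))

section AddValuation

variable {k L : Type*} [Field k] [Field L] [Algebra k L] (w : AddValuation L (WithTop ℚ))

theorem AddValuation.natCast_nonneg (m : ℕ) : 0 ≤ w (m : L) := by
  induction m with
  | zero => simp
  | succ m ih =>
    rw [Nat.cast_succ]
    exact w.map_le_add ih w.map_one.ge

theorem AddValuation.le_aeval {c : WithTop ℚ} {h : k[X]}
    (hc : ∀ i, c ≤ w (algebraMap k L (h.coeff i))) {x : L} (hx : 0 ≤ w x) :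
    c ≤ w (aeval x h) := by
  rw [aeval_eq_sum_range]
  refine w.map_le_sum fun i _ => ?_
  rw [Algebra.smul_def, w.map_mul, w.map_pow]
  simpa using add_le_add (hc i) (nsmul_nonneg hx i)

theorem AddValuation.le_aeval_derivative {c : WithTop ℚ} {h : k[X]}
    (hc : ∀ i, c ≤ w (algebraMap k L (h.coeff i))) {x : L} (hx : 0 ≤ w x) :
    c ≤ w (aeval x (derivative h)) := by
  refine w.le_aeval (fun i => ?_) hx
  rw [coeff_derivative, _root_.map_mul, w.map_mul]
  have := w.natCast_nonneg (i + 1)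
  push_cast at this
  simpa using add_le_add (hc (i + 1)) this

theorem AddValuation.eval_prod_X_sub_C (s : Multiset L) (x : L) :
    w ((s.map fun a => X - C a).prod.eval x) = (s.map fun a => w (x - a)).sum := by
  induction s using Multiset.induction_on with
  | empty => simp
  | cons a s ih => simp [ih]

/-- The logarithmic derivative `∑ 1 / (x - a)` of `∏ (X - a)` has valuation at least `-r` at `x`
if all `x - a` have valuation at most `r`. -/
theorem AddValuation.eval_prod_X_sub_C_le_derivative {s : Multiset L} {x : L} {r : WithTop ℚ}
    (hr : ∀ a ∈ s, w (x - a) ≤ r) :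
    w ((s.map fun a => X - C a).prod.eval x) ≤
      w ((derivative (s.map fun a => X - C a).prod).eval x) + r := by
  induction s using Multiset.induction_on with
  | empty => simp
  | cons a s ih =>
    have ih := ih fun b hb => hr b (Multiset.mem_cons_of_mem hb)
    have ha := hr a (Multiset.mem_cons_self a s)
    simp only [Multiset.map_cons, Multiset.prod_cons, derivative_mul, derivative_sub, derivative_X,
      derivative_C, sub_zero, one_mul, eval_add, eval_mul, eval_sub, eval_X, eval_C, w.map_mul]
    rcases le_total (w ((s.map fun a => X - C a).prod.eval x))
      (w ((x - a) * (derivative (s.map fun a => X - C a).prod).eval x)) with h | h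
    · have := w.map_le_add le_rfl h
      rw [add_comm]
      exact add_le_add this ha
    · have := w.map_le_add h le_rfl
      refine (add_le_add le_rfl ih).trans ?_
      rw [← add_assoc, ← w.map_mul]
      exact add_le_add this le_rfl

/-- Exponential of a rational number or `⊤` with base `b⁻¹`, where `⊤` is sent to `0`. -/
noncomputable def expNeg (b : ℝ) : WithTop ℚ → ℝ
  | ⊤ => 0
  | (q : ℚ) => b ^ (-(q : ℝ))

theorem expNeg_top (b : ℝ) : expNeg b ⊤ = 0 := rfl

theorem expNeg_coe (b : ℝ) (q : ℚ) : expNeg b (q : WithTop ℚ) = b ^ (-(q : ℝ)) := rfl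

theorem expNeg_nonneg {b : ℝ} (hb : 0 < b) (x : WithTop ℚ) : 0 ≤ expNeg b x := by
  cases x with
  | top => rfl
  | coe q => exact (Real.rpow_pos_of_pos hb _).le

theorem expNeg_eq_zero {b : ℝ} (hb : 0 < b) {x : WithTop ℚ} : expNeg b x = 0 ↔ x = ⊤ := by
  cases x with
  | top => simp [expNeg_top]
  | coe q => simp [expNeg_coe, (Real.rpow_pos_of_pos hb _).ne']

theorem expNeg_add {b : ℝ} (hb : 0 < b) (x y : WithTop ℚ) :
    expNeg b (x + y) = expNeg b x * expNeg b y := by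
  cases x with
  | top => simp [expNeg_top]
  | coe q =>
    cases y with
    | top => simp [expNeg_top]
    | coe r =>
      rw [← WithTop.coe_add, expNeg_coe, expNeg_coe, expNeg_coe, ← Real.rpow_add hb]
      push_cast
      ring_nf

theorem expNeg_strictAnti {b : ℝ} (hb : 1 < b) : StrictAnti (expNeg b) := by
  intro x y hxy
  cases x with
  | top => simp at hxy
  | coe q =>
    cases y with
    | top => exact Real.rpow_pos_of_pos (zero_lt_one.trans hb) _
    | coe r =>
      rw [expNeg_coe, expNeg_coe]
      have : (q : ℝ) < r := by exact_mod_cast hxy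
      exact Real.rpow_lt_rpow_of_exponent_lt hb (by linarith)

/-- The real absolute value `b ^ (-w x)` attached to an additive valuation `w`. -/
noncomputable def AddValuation.toAbsoluteValue {b : ℝ} (hb : 1 < b) : AbsoluteValue L ℝ where
  toFun x := expNeg b (w x)
  map_mul' x y := by rw [w.map_mul, expNeg_add (zero_lt_one.trans hb)]
  nonneg' x := expNeg_nonneg (zero_lt_one.trans hb) _
  eq_zero' x := by rw [expNeg_eq_zero (zero_lt_one.trans hb), w.top_iff]
  add_le' x y := by
    have hx := expNeg_nonneg (zero_lt_one.trans hb) (w x)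
    have hy := expNeg_nonneg (zero_lt_one.trans hb) (w y)
    have h := (expNeg_strictAnti hb).antitone (w.map_add x y)
    rw [(expNeg_strictAnti hb).antitone.map_min] at h
    exact h.trans (max_le (by linarith) (by linarith))

theorem AddValuation.toAbsoluteValue_apply {b : ℝ} (hb : 1 < b) (x : L) :
    w.toAbsoluteValue hb x = expNeg b (w x) := rfl

end AddValuation

namespace PadicSetup

variable (S : PadicSetup p K Ω)

/-- The valuation of a `PadicSetup` as an `AddValuation`. -/
def addValuation : AddValuation Ω (WithTop ℚ) :=
  AddValuation.of S.v ((S.v_top_iff 0).2 rfl)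
    (by
      have h := S.v_mul 1 1
      have h1 := (S.v_top_iff 1).not.2 one_ne_zero
      rw [mul_one] at h
      lift S.v 1 to ℚ using h1 with q
      have : q = q + q := by exact_mod_cast h
      have : q = 0 := by linarith
      rw [this, WithTop.coe_zero])
    S.v_add S.v_mul

theorem addValuation_apply (x : Ω) : S.addValuation x = S.v x := rfl

/-- The extension of the `p`-adic valuation to an algebraic extension is unique, hence invariant
under automorphisms. -/
theorem addValuation_algEquiv [Algebra.IsAlgebraic ℚ_[p] Ω] (σ : Ω ≃ₐ[ℚ_[p]] Ω) (x : Ω) :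
    S.addValuation (σ x) = S.addValuation x := by
  have hp : (1 : ℝ) < p := by exact_mod_cast (Fact.out : p.Prime).one_lt
  have he : (0 : ℝ) < S.e := by exact_mod_cast S.e_pos
  have hb : (1 : ℝ) < (p : ℝ) ^ ((S.e : ℝ)⁻¹) := Real.one_lt_rpow hp (inv_pos.2 he)
  have hext (y : ℚ_[p]) : S.addValuation.toAbsoluteValue hb (algebraMap ℚ_[p] Ω y) = ‖y‖ := by
    rcases eq_or_ne y 0 with rfl | hy
    · simp
    · rw [AddValuation.toAbsoluteValue_apply, addValuation_apply, S.v_padic y hy, expNeg_coe,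
        Padic.norm_eq_zpow_neg_valuation hy, ← Real.rpow_mul (by positivity), ← Real.rpow_intCast]
      congr 1
      push_cast
      field_simp
  apply (expNeg_strictAnti hb).injective
  rw [← AddValuation.toAbsoluteValue_apply _ hb, ← AddValuation.toAbsoluteValue_apply _ hb,
    spectralNorm_unique_field_norm_ext hext, spectralNorm_unique_field_norm_ext hext,
    ← spectralNorm_eq_of_equiv]

theorem IsEisensteinOfDegree.addValuation_root {S : PadicSetup p K Ω} {f : K[X]} {n : ℕ}
    (hf : S.IsEisensteinOfDegree f n) (hn : 0 < n) {x : Ω} (hx : aeval x f = 0) :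
    S.addValuation x = ((1 / n : ℚ) : WithTop ℚ) := by
  obtain ⟨hm, hd, hlow, h0⟩ := hf
  set w := S.addValuation
  change ∀ i < n, 1 ≤ w (algebraMap K Ω (f.coeff i)) at hlow
  change w (algebraMap K Ω (f.coeff 0)) = 1 at h0
  obtain ⟨m, rfl⟩ : ∃ m, n = m + 1 := ⟨n - 1, by omega⟩
  have hlead : f.coeff (m + 1) = 1 := hd ▸ hm.coeff_natDegree
  rw [aeval_eq_sum_range, hd, Finset.sum_range_succ, hlead, one_smul] at hx
  have hx0 : x ≠ 0 := by
    rintro rfl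
    simp [Finset.sum_range_succ', Algebra.smul_def] at hx
    simp [hx] at h0
  obtain ⟨q, hq⟩ : ∃ q : ℚ, w x = q :=
    ⟨_, (WithTop.coe_untop _ (w.ne_top_iff.2 hx0)).symm⟩
  have hpow (i : ℕ) : w (x ^ i) = ((i * q : ℚ) : WithTop ℚ) := by
    rw [w.map_pow, hq, ← WithTop.coe_nsmul, nsmul_eq_mul]
  have hterm (i : ℕ) (hi : i < m + 1) :
      ((1 + i * q : ℚ) : WithTop ℚ) ≤ w (f.coeff i • x ^ i) := by
    rw [Algebra.smul_def, w.map_mul, hpow, WithTop.coe_add]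
    exact add_le_add (hlow i hi) le_rfl
  have hqpos : 0 < q := by
    by_contra! hq0
    have hlt : w (x ^ (m + 1)) < w (∑ i ∈ Finset.range (m + 1), f.coeff i • x ^ i) := by
      rw [hpow]
      refine w.map_lt_sum WithTop.coe_ne_top fun i hi => lt_of_lt_of_le ?_
        (hterm i (Finset.mem_range.1 hi))
      have : (i : ℚ) ≤ (m + 1 : ℕ) := by exact_mod_cast (Finset.mem_range.1 hi).le
      exact WithTop.coe_lt_coe.2 (by nlinarith)
    have := w.map_add_eq_of_lt_right hlt
    rw [hx, w.map_zero, hpow] at this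
    exact WithTop.top_ne_coe this
  have hsum : w (∑ i ∈ Finset.range (m + 1), f.coeff i • x ^ i) = 1 := by
    have h00 : w (f.coeff 0 • x ^ 0) = 1 := by rw [pow_zero, Algebra.smul_def, mul_one, h0]
    rw [Finset.sum_range_succ', w.map_add_eq_of_lt_right, h00]
    rw [h00]
    refine w.map_lt_sum WithTop.one_ne_top fun i hi => lt_of_lt_of_le ?_
        (hterm (i + 1) (by simpa using hi))
    rw [← WithTop.coe_one, WithTop.coe_lt_coe]
    have : (0 : ℚ) < (i + 1 : ℕ) := by positivity
    nlinarith
  rw [eq_neg_of_add_eq_zero_left hx, w.map_neg, hpow] at hsum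
  have hmq : ((m + 1 : ℕ) : ℚ) * q = 1 := by exact_mod_cast hsum
  rw [hq, WithTop.coe_inj, eq_div_iff (by positivity), mul_comm, hmq]

theorem IsEisensteinOfDegree.le_natDegree_minpoly [IsAlgClosed Ω] {S : PadicSetup p K Ω}
    {f : K[X]} {n : ℕ} (hf : S.IsEisensteinOfDegree f n) (hn : 0 < n) {x : Ω}
    (hx : aeval x f = 0) : n ≤ (minpoly K x).natDegree := by
  have hint : IsIntegral K x := ⟨f, hf.1, hx⟩
  set h := minpoly K x
  have hm : h.Monic := minpoly.monic hint
  have hroots : ∀ y ∈ (h.map (algebraMap K Ω)).roots,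
      S.addValuation (0 - y) = ((1 / n : ℚ) : WithTop ℚ) := by
    intro y hy
    rw [mem_roots_map hm.ne_zero] at hy
    rw [zero_sub, AddValuation.map_neg]
    exact hf.addValuation_root hn (aeval_eq_zero_of_dvd_aeval_eq_zero (minpoly.dvd K x hx) hy)
  have hsplits := IsAlgClosed.splits (h.map (algebraMap K Ω))
  have hval := S.addValuation.eval_prod_X_sub_C (h.map (algebraMap K Ω)).roots 0
  rw [← hsplits.eq_prod_roots_of_monic (hm.map _), ← coeff_zero_eq_eval_zero, coeff_map,
    Multiset.map_congr rfl hroots, Multiset.map_const', Multiset.sum_replicate,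
    ← hsplits.natDegree_eq_card_roots, natDegree_map, ← WithTop.coe_nsmul] at hval
  have h0 : h.coeff 0 ≠ 0 := by
    intro h0
    rw [h0, map_zero, AddValuation.map_zero] at hval
    exact WithTop.top_ne_coe hval
  obtain ⟨k, hk⟩ := S.v_int _ h0
  rw [addValuation_apply, hk, WithTop.coe_inj, nsmul_eq_mul] at hval
  have hn' : (n : ℚ) ≠ 0 := by positivity
  have hdvd : (n : ℤ) ∣ h.natDegree := by
    refine ⟨k, ?_⟩
    have : (h.natDegree : ℚ) = n * k := by rw [hval]; field_simp
    exact_mod_cast this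
  exact Nat.le_of_dvd (minpoly.natDegree_pos hint) (by exact_mod_cast hdvd)

/-- Krasner's lemma: if `y` is closer to `x` than every other conjugate of `x`
is, then `x ∈ K(y)`. -/
theorem mem_adjoin_of_lt [FiniteDimensional ℚ_[p] K] [IsAlgClosed Ω] [Algebra.IsAlgebraic K Ω]
    {x y : Ω} (h : ∀ σ : Ω ≃ₐ[K] Ω, σ x ≠ x → S.v (x - σ x) < S.v (y - x)) :
    x ∈ IntermediateField.adjoin K {y} := by
  have : CharZero K := charZero_of_injective_algebraMap (algebraMap ℚ_[p] K).injective
  have : Algebra.IsAlgebraic ℚ_[p] Ω := Algebra.IsAlgebraic.trans ℚ_[p] K Ω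
  have : IsAlgClosure K Ω := ⟨inferInstance, inferInstance⟩
  have : Normal K Ω := IsAlgClosure.normal K Ω
  have : IsGalois K Ω := ⟨⟩
  rw [← InfiniteGalois.fixedField_fixingSubgroup (IntermediateField.adjoin K {y}),
    IntermediateField.mem_fixedField_iff]
  intro σ hσ
  by_contra hne
  have hy : σ y = y := (mem_fixingSubgroup_iff _).1 hσ y
    (IntermediateField.mem_adjoin_simple_self K y)
  have hinv := S.addValuation_algEquiv (σ.restrictScalars ℚ_[p]) (y - x)
  rw [AlgEquiv.restrictScalars_apply, map_sub, hy] at hinv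
  refine (h σ hne).not_ge ?_
  rw [← addValuation_apply, ← addValuation_apply, show x - σ x = (y - σ x) - (y - x) by ring]
  exact S.addValuation.map_le_sub hinv.ge le_rfl

end PadicSetup

theorem Multiset.add_nsmul_le_sum {M : Type*} [AddCommMonoid M] [PartialOrder M]
    [IsOrderedAddMonoid M] {s : Multiset M} {q a : M} (hs : ∀ b ∈ s, q ≤ b) (ha : a ∈ s) :
    a + (s.card - 1) • q ≤ s.sum := by
  obtain ⟨t, rfl⟩ := Multiset.exists_cons_of_mem ha
  rw [Multiset.card_cons, Nat.add_sub_cancel, Multiset.sum_cons]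
  exact add_le_add le_rfl
    (Multiset.card_nsmul_le_sum fun b hb => hs b (Multiset.mem_cons_of_mem hb))

/-- **Krasner's disc covering.** Let `f` be Eisenstein of degree `n` over `K`
with `v_P(disc f) = n + J₀ - 1` (expressed via a root `α` as `v_α(f'(α)) = n + J₀ - 1`),
and let `c > 1 + 2J₀/n` be rational.  If `g` is monic of degree `n` with integral
coefficients and `v_P(g_i - f_i) ≥ c` for all `i`, and `β` is a root of `g` closest to `α`,
then `α ∈ K(β)`, `K(α) = K(β)`, `g` is Eisenstein of degree `n`, and `g` has the same
discriminant valuation `n + J₀ - 1`. -/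
theorem krasner_disc_covering
    [FiniteDimensional ℚ_[p] K] [IsAlgClosed Ω] [Algebra.IsAlgebraic K Ω]
    (S : PadicSetup p K Ω)
    (f : K[X]) (n J₀ : ℕ) (hn : 0 < n) (hf : S.IsEisensteinOfDegree f n)
    (α : Ω) (hα : aeval α f = 0)
    (hdisc : ((n : ℚ) : WithTop ℚ) * S.v (aeval α (derivative f)) =
      ((((n : ℤ) + (J₀ : ℤ) - 1 : ℤ) : ℚ) : WithTop ℚ))
    (c : ℚ) (hc : 1 + 2 * (J₀ : ℚ) / (n : ℚ) < c)
    (g : K[X]) (hgm : g.Monic) (hgd : g.natDegree = n)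
    (hgint : ∀ i, 0 ≤ S.v (algebraMap K Ω (g.coeff i)))
    (hcong : ∀ i, ((c : ℚ) : WithTop ℚ) ≤ S.v (algebraMap K Ω (g.coeff i - f.coeff i)))
    (β : Ω) (hβ : aeval β g = 0)
    (hclosest : ∀ β' ∈ (g.map (algebraMap K Ω)).roots, S.v (β' - α) ≤ S.v (β - α)) :
    α ∈ IntermediateField.adjoin K {β}
    ∧ IntermediateField.adjoin K {α} = IntermediateField.adjoin K {β}
    ∧ S.IsEisensteinOfDegree g n
    ∧ ((n : ℚ) : WithTop ℚ) * S.v (aeval β (derivative g)) =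
        ((((n : ℤ) + (J₀ : ℤ) - 1 : ℤ) : ℚ) : WithTop ℚ) := by
  set w := S.addValuation
  change ∀ i, 0 ≤ w (algebraMap K Ω (g.coeff i)) at hgint
  change ∀ i, (c : WithTop ℚ) ≤ w (algebraMap K Ω (g.coeff i - f.coeff i)) at hcong
  change ∀ β' ∈ (g.map (algebraMap K Ω)).roots, w (β' - α) ≤ w (β - α) at hclosest
  have hnQ : (0 : ℚ) < n := by exact_mod_cast hn
  have hJQ : (0 : ℚ) ≤ J₀ := J₀.cast_nonneg
  set D : ℚ := 1 + (J₀ - 1) / n with hD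
  set R : ℚ := (J₀ + 1) / n with hR
  have hDR : D + R < c := by
    have : D + R = 1 + 2 * J₀ / n := by rw [hD, hR]; ring
    rwa [this]
  have hRpos : 0 < R := by positivity
  have hDc : D < c := by linarith
  have hc1 : 1 < c := lt_of_le_of_lt (le_add_of_nonneg_right (by positivity)) hc
  have hnD : (n : ℚ) * D = ((n + J₀ - 1 : ℤ) : ℚ) := by
    rw [hD]; push_cast; field_simp; ring
  rw [← hnD, WithTop.coe_mul] at hdisc ⊢
  have hn_top : ((n : ℚ) : WithTop ℚ) ≠ 0 := by exact_mod_cast hnQ.ne'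
  have hDf : w (aeval α (derivative f)) = D := by
    change ((n : ℚ) : WithTop ℚ) * w (aeval α (derivative f)) = _ at hdisc
    cases hw : w (aeval α (derivative f)) with
    | top =>
      rw [hw, WithTop.mul_top hn_top, ← WithTop.coe_mul] at hdisc
      exact absurd hdisc WithTop.top_ne_coe
    | coe q =>
      rw [hw, ← WithTop.coe_mul, ← WithTop.coe_mul, WithTop.coe_inj] at hdisc
      rw [mul_left_cancel₀ hnQ.ne' hdisc]
  -- `g` is Eisenstein
  have hg : S.IsEisensteinOfDegree g n := by
    have hlt : (1 : WithTop ℚ) < c := by exact_mod_cast hc1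
    refine ⟨hgm, hgd, fun i hi => ?_, ?_⟩
    · have := w.map_le_add (hf.2.2.1 i hi) (hlt.le.trans (hcong i))
      rwa [← map_add, add_sub_cancel] at this
    · have h0 : w (algebraMap K Ω (f.coeff 0)) = 1 := hf.2.2.2
      have := w.map_add_eq_of_lt_left (h0.trans_lt (hlt.trans_le (hcong 0)))
      rwa [← map_add, add_sub_cancel, h0] at this
  have hαv : w α = ((1 / n : ℚ) : WithTop ℚ) := hf.addValuation_root hn hα
  have hβv : w β = ((1 / n : ℚ) : WithTop ℚ) := hg.addValuation_root hn hβ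
  have hv0 : (0 : WithTop ℚ) ≤ ((1 / n : ℚ) : WithTop ℚ) := by
    exact_mod_cast (by positivity : (0 : ℚ) ≤ 1 / n)
  have hcong' : ∀ i, (c : WithTop ℚ) ≤ w (algebraMap K Ω ((g - f).coeff i)) := by
    simpa only [coeff_sub] using hcong
  have hgα : (c : WithTop ℚ) ≤ w (aeval α g) := by
    simpa [hα] using w.le_aeval hcong' (hv0.trans hαv.ge)
  have hderiv {x : Ω} (hx : 0 ≤ w x) (hfx : w (aeval x (derivative f)) = D) :
      w (aeval x (derivative g)) = D := by
    have h1 := w.le_aeval_derivative hcong' hx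
    rw [derivative_sub, map_sub] at h1
    have hlt : (D : WithTop ℚ) < c := by exact_mod_cast hDc
    rw [← hfx]
    exact w.map_eq_of_lt_sub (hfx.trans_lt (hlt.trans_le h1))
  -- distance from `α` to `β`
  have hαβ : (R : WithTop ℚ) < w (β - α) := by
    have hle := w.eval_prod_X_sub_C_le_derivative (s := (g.map (algebraMap K Ω)).roots) (x := α)
      (r := w (β - α)) fun b hb => w.map_sub_swap α b ▸ hclosest b hb
    rw [← (IsAlgClosed.splits _).eq_prod_roots_of_monic (hgm.map _), derivative_map,
      eval_map_algebraMap, eval_map_algebraMap, hderiv (hv0.trans hαv.ge) hDf] at hle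
    have hle := hgα.trans hle
    cases hr : w (β - α) with
    | top => exact WithTop.coe_lt_top _
    | coe r =>
      rw [hr] at hle
      have : c ≤ D + r := by exact_mod_cast hle
      exact_mod_cast (by linarith : R < r)
  -- distances between conjugates of `α`
  have hfm : (f.map (algebraMap K Ω)).Monic := hf.1.map _
  have hroot (a : Ω) : a ∈ (f.map (algebraMap K Ω)).roots ↔ aeval a f = 0 :=
    mem_roots_map hf.1.ne_zero
  obtain ⟨s, hs⟩ := Multiset.exists_cons_of_mem ((hroot α).2 hα)
  have hsplits := IsAlgClosed.splits (f.map (algebraMap K Ω))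
  have hcard : s.card + 1 = n := by
    rw [← Multiset.card_cons α, ← hs, ← hsplits.natDegree_eq_card_roots, natDegree_map, hf.2.1]
  set P := (s.map fun a => X - C a).prod with hP
  have hfac : f.map (algebraMap K Ω) = (X - C α) * P := by
    rw [hsplits.eq_prod_roots_of_monic hfm, hs, Multiset.map_cons, Multiset.prod_cons]
  have hfderiv (x : Ω) : aeval x (derivative f) = P.eval x + (x - α) * (derivative P).eval x := by
    rw [← eval_map_algebraMap, ← derivative_map, hfac]
    simp [derivative_mul]
  have hPα : w (P.eval α) = D := by
    rw [← hDf, hfderiv, sub_self, zero_mul, add_zero]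
  have hconj : ∀ a ∈ s, w (α - a) ≤ R := by
    intro a ha
    have hmin : ∀ b ∈ s.map (fun a => w (α - a)), ((1 / n : ℚ) : WithTop ℚ) ≤ b := by
      intro b hb
      obtain ⟨a, ha, rfl⟩ := Multiset.mem_map.1 hb
      have := (hroot a).1 (hs ▸ Multiset.mem_cons_of_mem ha)
      exact w.map_le_sub hαv.ge (hf.addValuation_root hn this).ge
    have hle := Multiset.add_nsmul_le_sum hmin (Multiset.mem_map_of_mem (fun a => w (α - a)) ha)
    rw [← w.eval_prod_X_sub_C, hPα, Multiset.card_map, ← WithTop.coe_nsmul] at hle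
    cases hr : w (α - a) with
    | top => simp [hr] at hle
    | coe r =>
      rw [hr] at hle
      have hle : r + (s.card - 1) • (1 / n : ℚ) ≤ D := by exact_mod_cast hle
      have hpos : 1 ≤ s.card := Multiset.card_pos_iff_exists_mem.2 ⟨a, ha⟩
      have hsc : ((s.card - 1 : ℕ) : ℚ) = n - 2 := by
        rw [Nat.cast_sub hpos, ← hcard]; push_cast; ring
      rw [nsmul_eq_mul, hsc] at hle
      have : D = R + (n - 2) * (1 / n) := by rw [hD, hR]; field_simp; ring
      exact_mod_cast (by linarith : r ≤ R)
  have hmem : α ∈ IntermediateField.adjoin K {β} := by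
    refine S.mem_adjoin_of_lt fun σ hσ => ?_
    have hσα : σ α ∈ α ::ₘ s := by
      rw [← hs, hroot, aeval_algEquiv, AlgHom.comp_apply, hα]
      simp
    exact (hconj _ ((Multiset.mem_cons.1 hσα).resolve_left hσ)).trans_lt hαβ
  have hle : IntermediateField.adjoin K {α} ≤ IntermediateField.adjoin K {β} :=
    IntermediateField.adjoin_simple_le_iff.2 hmem
  have hαint : IsIntegral K α := ⟨f, hf.1, hα⟩
  have hβint : IsIntegral K β := ⟨g, hgm, hβ⟩
  refine ⟨hmem, ?_, hg, ?_⟩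
  · have := IntermediateField.adjoin.finiteDimensional hβint
    refine IntermediateField.eq_of_le_of_finrank_le hle ?_
    rw [IntermediateField.adjoin.finrank hαint, IntermediateField.adjoin.finrank hβint]
    refine le_trans ?_ (hf.le_natDegree_minpoly hn hα)
    exact hgd ▸ natDegree_le_of_dvd (minpoly.dvd K β hβ) hgm.ne_zero
  · have hβa : ∀ a ∈ s, w (β - a) = w (α - a) := by
      intro a ha
      rw [← sub_add_sub_cancel β α a]
      exact w.map_add_eq_of_lt_right ((hconj a ha).trans_lt hαβ)
    have hPβ : w (P.eval β) = D := by
      rw [← hPα, w.eval_prod_X_sub_C, w.eval_prod_X_sub_C, Multiset.map_congr rfl hβa]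
    have hlt : w (P.eval β) < w ((β - α) * (derivative P).eval β) := by
      have h1 := w.eval_prod_X_sub_C_le_derivative (s := s) (x := β) (r := R)
        fun a ha => (hβa a ha).trans_le (hconj a ha)
      rw [← hP, hPβ] at h1
      rw [hPβ, w.map_mul, add_comm]
      cases hd : w ((derivative P).eval β) with
      | top => simp
      | coe d =>
        rw [hd] at h1
        exact h1.trans_lt (WithTop.add_lt_add_left WithTop.coe_ne_top hαβ)
    have hfβ : w (aeval β (derivative f)) = D := by
      rw [hfderiv, w.map_add_eq_of_lt_left hlt, hPβ]
    exact congrArg _ (hderiv (hv0.trans hβv.ge) hfβ)
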